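/- Theorem 1, first relation: if P is a point in the interior of the triangle T with gradient V P = 0, then, writing a = dist B C, b = dist C A, c = dist A B, r_A = dist P A, r_B = dist P B, r_C = dist P C, one has ((r_B + r_C − a)/(r_B + r_C + a)) ^ (1/a) = ((r_C + r_A − b)/(r_C + r_A + b)) ^ (1/b) = ((r_A + r_B − c)/(r_A + r_B + c)) ^ (1/c), where x ^ y denotes the real power Real.rpow. -/

import Mathlib

open MeasureTheory

/-- The closed unit right triangle in the plane. -/
def unitTriangle : Set (ℝ × ℝ) := {z | 0 ≤ z.1 ∧ 0 ≤ z.2 ∧ z.1 + z.2 ≤ 1}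

lemma isClosed_unitTriangle : IsClosed unitTriangle :=
  (isClosed_le continuous_const continuous_fst).inter
    ((isClosed_le continuous_const continuous_snd).inter
      (isClosed_le (continuous_fst.add continuous_snd) continuous_const))

lemma isCompact_unitTriangle : IsCompact unitTriangle := by
  refine (isCompact_Icc (a := ((0 : ℝ), (0 : ℝ))) (b := (1, 1))).of_isClosed_subset
    isClosed_unitTriangle ?_
  rintro ⟨x, y⟩ ⟨h1, h2, h3⟩
  simp only [Set.mem_Icc, Prod.mk_le_mk] at *
  exact ⟨⟨h1, h2⟩, by linarith, by linarith⟩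

lemma integrable_indicator_unitTriangle {f : ℝ × ℝ → ℝ} (hf : LocallyIntegrable f) (p : ℝ × ℝ) :
    Integrable (unitTriangle.indicator fun z ↦ f (z - p)) := by
  rw [integrable_indicator_iff isClosed_unitTriangle.measurableSet]
  have hmp : MeasurePreserving (fun z : ℝ × ℝ ↦ z - p) volume volume :=
    measurePreserving_sub_right volume p
  have hK : IsCompact ((fun z : ℝ × ℝ ↦ z - p) '' unitTriangle) :=
    isCompact_unitTriangle.image (by fun_prop)
  exact ((hmp.integrableOn_image (MeasurableEquiv.subRight p).measurableEmbedding).1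
    (hf.integrableOn_isCompact hK))

lemma indicator_unitTriangle_slice (g : ℝ × ℝ → ℝ) (s : ℝ) :
    ∫ x, unitTriangle.indicator g (x, s) =
      (Set.Icc (0 : ℝ) 1).indicator (fun s ↦ ∫ x in (0 : ℝ)..(1 - s), g (x, s)) s := by
  by_cases hs : s ∈ Set.Icc (0 : ℝ) 1
  · rw [Set.indicator_of_mem hs, intervalIntegral.integral_of_le (by linarith [hs.2]),
      ← integral_Icc_eq_integral_Ioc, ← integral_indicator measurableSet_Icc]
    congr 1 with x
    simp only [Set.indicator_apply, unitTriangle, Set.mem_ofPred_eq, Set.mem_Icc]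
    congr 1
    have := hs.1
    exact propext ⟨fun h ↦ ⟨h.1, by linarith [h.2.2]⟩, fun h ↦ ⟨h.1, this, by linarith [h.2]⟩⟩
  · rw [Set.indicator_of_notMem hs]
    have : ∀ x, unitTriangle.indicator g (x, s) = 0 := fun x ↦
      Set.indicator_of_notMem (fun h : (x, s) ∈ unitTriangle ↦ hs ⟨h.2.1, by
        have h1 := h.1
        have h2 := h.2.2
        simp only at h1 h2
        linarith⟩) _
    simp [this]

lemma setIntegral_unitTriangle {f : ℝ × ℝ → ℝ} (hf : LocallyIntegrable f) (u v : ℝ) :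
    IntervalIntegrable (fun s ↦ ∫ x in (-u)..(1 - s - u), f (x, s - v)) volume 0 1 ∧
    ∫ z in unitTriangle, f (z - (u, v)) =
      ∫ s in (0 : ℝ)..1, ∫ x in (-u)..(1 - s - u), f (x, s - v) := by
  have hint := integrable_indicator_unitTriangle hf (u, v)
  have hslice : ∀ s : ℝ, ∫ x, unitTriangle.indicator (fun z ↦ f (z - (u, v))) (x, s) =
      (Set.Icc (0 : ℝ) 1).indicator (fun s ↦ ∫ x in (-u)..(1 - s - u), f (x, s - v)) s := by
    intro s
    rw [indicator_unitTriangle_slice]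
    congr 1 with s
    have := intervalIntegral.integral_comp_sub_right (a := 0) (b := 1 - s)
      (fun x ↦ f (x, s - v)) u
    simpa using this
  constructor
  · have h := hint.integral_prod_right
    simp_rw [hslice] at h
    rw [integrable_indicator_iff measurableSet_Icc] at h
    exact (intervalIntegrable_iff_integrableOn_Icc_of_le zero_le_one).2 h
  · rw [← integral_indicator isClosed_unitTriangle.measurableSet, Measure.volume_eq_prod,
      integral_prod_symm _ hint]
    simp_rw [hslice]
    rw [integral_indicator measurableSet_Icc, integral_Icc_eq_integral_Ioc,
      intervalIntegral.integral_of_le zero_le_one]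

lemma hasDerivAt_setIntegral_unitTriangle {f : ℝ × ℝ → ℝ} (hfc : ContinuousOn f {0}ᶜ)
    (hf : LocallyIntegrable f) {u v : ℝ} (hu : 0 < u) (huv : u + v < 1) :
    HasDerivAt (fun t ↦ ∫ z in unitTriangle, f (z - (t, v)))
      (∫ s in (0 : ℝ)..1, (f (-u, s - v) - f (1 - s - u, s - v))) u := by
  simp_rw [(setIntegral_unitTriangle hf _ v).2]
  obtain ⟨ε, hε, hε1, hε2⟩ : ∃ ε : ℝ, 0 < ε ∧ 0 < u - ε ∧ u + ε + v < 1 :=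
    ⟨min (u / 2) ((1 - u - v) / 2), lt_min (by linarith) (by linarith),
      by linarith [min_le_left (u / 2) ((1 - u - v) / 2)],
      by linarith [min_le_right (u / 2) ((1 - u - v) / 2)]⟩
  have hcont : ContinuousOn (fun q : ℝ × ℝ ↦ f (-q.1, q.2 - v) - f (1 - q.2 - q.1, q.2 - v))
      (Set.Icc (u - ε) (u + ε) ×ˢ Set.Icc 0 1) := by
    apply ContinuousOn.sub
    · refine hfc.comp (by fun_prop) ?_
      rintro ⟨t, s⟩ ⟨ht, -⟩ h
      simp only [Set.mem_singleton_iff, Prod.mk_eq_zero] at h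
      simp only [Set.mem_Icc] at ht
      linarith [h.1]
    · refine hfc.comp (by fun_prop) ?_
      rintro ⟨t, s⟩ ⟨ht, -⟩ h
      simp only [Set.mem_singleton_iff, Prod.mk_eq_zero] at h
      simp only [Set.mem_Icc] at ht
      linarith [h.1, h.2]
  obtain ⟨M, hM⟩ := (isCompact_Icc.prod isCompact_Icc).exists_bound_of_continuousOn hcont
  refine (intervalIntegral.hasDerivAt_integral_of_dominated_loc_of_deriv_le
    (F := fun t s ↦ ∫ x in (-t)..(1 - s - t), f (x, s - v))
    (F' := fun t s ↦ f (-t, s - v) - f (1 - s - t, s - v))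
    (Icc_mem_nhds (by linarith : u - ε < u) (by linarith : u < u + ε))
    (Filter.Eventually.of_forall fun t ↦
      (setIntegral_unitTriangle hf t v).1.def'.aestronglyMeasurable)
    (setIntegral_unitTriangle hf u v).1 ?_ (bound := fun _ ↦ M) ?_ (by simp) ?_).2
  · refine ContinuousOn.aestronglyMeasurable ?_ measurableSet_uIoc
    rw [Set.uIoc_of_le zero_le_one]
    exact hcont.comp (f := fun s : ℝ ↦ (u, s)) (by fun_prop)
      fun s hs ↦ ⟨⟨by simp [hε.le], by simp [hε.le]⟩, hs.1.le, hs.2⟩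
  · refine Filter.Eventually.of_forall fun s hs t ht ↦ ?_
    rw [Set.uIoc_of_le zero_le_one] at hs
    exact hM (t, s) ⟨ht, hs.1.le, hs.2⟩
  · have hne : ∀ᵐ s : ℝ, s ≠ v := by
      simp [ae_iff]
    filter_upwards [hne] with s hs _ t _
    have hg : Continuous fun x : ℝ ↦ f (x, s - v) := by
      rw [← continuousOn_univ]
      refine hfc.comp (by fun_prop) fun x _ h ↦ ?_
      simp only [Set.mem_singleton_iff, Prod.mk_eq_zero] at h
      exact hs (by linarith [h.2])
    have hsplit : ∀ t : ℝ, ∫ x in (-t)..(1 - s - t), f (x, s - v) =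
        (∫ x in (0 : ℝ)..(1 - s - t), f (x, s - v)) - ∫ x in (0 : ℝ)..(-t), f (x, s - v) := fun t ↦
      (intervalIntegral.integral_interval_sub_left (hg.intervalIntegrable _ _)
        (hg.intervalIntegrable _ _)).symm
    simp_rw [hsplit]
    have h1 := (hg.integral_hasStrictDerivAt 0 (1 - s - t)).hasDerivAt.comp t
      ((hasDerivAt_id t).const_sub (1 - s))
    have h2 := (hg.integral_hasStrictDerivAt 0 (-t)).hasDerivAt.comp t (hasDerivAt_neg t)
    refine (h1.sub h2).congr_deriv ?_
    ring

lemma continuousOn_edgeIntegral {f : ℝ × ℝ → ℝ} (hfc : ContinuousOn f {0}ᶜ) :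
    ContinuousOn (fun p : ℝ × ℝ ↦ ∫ s in (0 : ℝ)..1,
        (f (-p.1, s - p.2) - f (1 - s - p.1, s - p.2)))
      {p | 0 < p.1 ∧ p.1 + p.2 < 1} := by
  rw [continuousOn_iff_continuous_domRestrict]
  refine intervalIntegral.continuous_parametric_intervalIntegral_of_continuous'
    (f := fun (p : {p : ℝ × ℝ | 0 < p.1 ∧ p.1 + p.2 < 1}) s ↦
      f (-p.1.1, s - p.1.2) - f (1 - s - p.1.1, s - p.1.2)) ?_ 0 1
  refine Continuous.sub ?_ ?_
  · refine hfc.comp_continuous (f := fun q : {p : ℝ × ℝ | 0 < p.1 ∧ p.1 + p.2 < 1} × ℝ ↦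
      (-q.1.1.1, q.2 - q.1.1.2)) (by fun_prop) ?_
    rintro ⟨⟨p, hp⟩, s⟩ h
    simp only [Set.mem_singleton_iff, Prod.mk_eq_zero] at h
    linarith [h.1, hp.1]
  · refine hfc.comp_continuous (f := fun q : {p : ℝ × ℝ | 0 < p.1 ∧ p.1 + p.2 < 1} × ℝ ↦
      (1 - q.2 - q.1.1.1, q.2 - q.1.1.2)) (by fun_prop) ?_
    rintro ⟨⟨p, hp⟩, s⟩ h
    simp only [Set.mem_singleton_iff, Prod.mk_eq_zero] at h
    linarith [h.1, h.2, hp.2]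

lemma setIntegral_unitTriangle_swap (g : ℝ × ℝ → ℝ) :
    ∫ z in unitTriangle, g z.swap = ∫ z in unitTriangle, g z := by
  have h := (Measure.measurePreserving_swap (μ := (volume : Measure ℝ))
    (ν := (volume : Measure ℝ))).setIntegral_preimage_emb
      MeasurableEquiv.prodComm.measurableEmbedding g unitTriangle
  rw [← Measure.volume_eq_prod] at h
  rw [← h]
  congr 2
  ext ⟨x, y⟩
  simp only [unitTriangle, Set.mem_ofPred_eq, Set.mem_preimage, Prod.swap_prod_mk]
  rw [add_comm]
  tauto

lemma continuousOn_comp_swap {f : ℝ × ℝ → ℝ} (hfc : ContinuousOn f {0}ᶜ) :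
    ContinuousOn (fun z : ℝ × ℝ ↦ f z.swap) {0}ᶜ := by
  refine hfc.comp (by fun_prop) ?_
  rintro ⟨x, y⟩ h h'
  simp_all

lemma hasDerivAt_setIntegral_unitTriangle_snd {f : ℝ × ℝ → ℝ} (hfc : ContinuousOn f {0}ᶜ)
    (hf : LocallyIntegrable f) {u v : ℝ} (hv : 0 < v) (huv : u + v < 1) :
    HasDerivAt (fun t ↦ ∫ z in unitTriangle, f (z - (u, t)))
      (∫ s in (0 : ℝ)..1, (f (s - u, -v) - f (s - u, 1 - s - v))) v := by
  have hfc' := continuousOn_comp_swap hfc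
  have hf' : LocallyIntegrable (fun z ↦ f (Prod.swap z)) := by
    rw [locallyIntegrable_iff] at hf ⊢
    intro K hK
    have hswap : MeasurePreserving Prod.swap (volume : Measure (ℝ × ℝ)) volume :=
      Measure.measurePreserving_swap
    exact (hswap.integrableOn_image MeasurableEquiv.prodComm.measurableEmbedding).1
      (hf _ (hK.image continuous_swap))
  have h := hasDerivAt_setIntegral_unitTriangle hfc' hf' hv (by linarith : v + u < 1)
  refine h.congr_of_eventuallyEq (Filter.Eventually.of_forall fun t ↦ ?_)
  exact (setIntegral_unitTriangle_swap fun z ↦ f (z - (u, t))).symm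

lemma differentiableAt_setIntegral_unitTriangle {f : ℝ × ℝ → ℝ} (hfc : ContinuousOn f {0}ᶜ)
    (hf : LocallyIntegrable f) {u v : ℝ} (hu : 0 < u) (hv : 0 < v) (huv : u + v < 1) :
    DifferentiableAt ℝ (fun p : ℝ × ℝ ↦ ∫ z in unitTriangle, f (z - p)) (u, v) := by
  have hU₁ : IsOpen {p : ℝ × ℝ | 0 < p.1 ∧ p.1 + p.2 < 1} :=
    (isOpen_lt continuous_const continuous_fst).inter
      (isOpen_lt (continuous_fst.add continuous_snd) continuous_const)
  have hU₂ : IsOpen {p : ℝ × ℝ | 0 < p.2 ∧ p.1 + p.2 < 1} :=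
    (isOpen_lt continuous_const continuous_snd).inter
      (isOpen_lt (continuous_fst.add continuous_snd) continuous_const)
  have hfc' := continuousOn_comp_swap hfc
  have hc₁ := (continuousOn_edgeIntegral hfc).continuousAt
    (hU₁.mem_nhds (show (u, v) ∈ _ from ⟨hu, huv⟩))
  have hc₂ : ContinuousAt (fun p : ℝ × ℝ ↦ ∫ s in (0 : ℝ)..1,
      (f (s - p.1, -p.2) - f (s - p.1, 1 - s - p.2))) (u, v) :=
    ((continuousOn_edgeIntegral hfc').comp (s := {p : ℝ × ℝ | 0 < p.2 ∧ p.1 + p.2 < 1})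
      (f := Prod.swap) (by fun_prop) fun p hp ↦ ⟨hp.1, by simpa [add_comm] using hp.2⟩).continuousAt
        (hU₂.mem_nhds (show (u, v) ∈ _ from ⟨hv, huv⟩))
  refine (hasStrictFDerivAt_uncurry_coprod
    (f := fun x y ↦ ∫ z in unitTriangle, f (z - (x, y)))
    (f₁ := fun x y ↦ ContinuousLinearMap.toSpanSingleton ℝ
      (∫ s in (0 : ℝ)..1, (f (-x, s - y) - f (1 - s - x, s - y))))
    (f₂ := fun x y ↦ ContinuousLinearMap.toSpanSingleton ℝ
      (∫ s in (0 : ℝ)..1, (f (s - x, -y) - f (s - x, 1 - s - y))))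
    ?_ ?_ ?_ ?_).hasFDerivAt.differentiableAt
  · filter_upwards [hU₁.mem_nhds (show (u, v) ∈ _ from ⟨hu, huv⟩)] with p hp
    exact (hasDerivAt_setIntegral_unitTriangle hfc hf hp.1 hp.2).hasFDerivAt
  · filter_upwards [hU₂.mem_nhds (show (u, v) ∈ _ from ⟨hv, huv⟩)] with p hp
    exact (hasDerivAt_setIntegral_unitTriangle_snd hfc hf hp.1 hp.2).hasFDerivAt
  · exact ContinuousLinearMap.toSpanSingletonCLE.continuous.continuousAt.comp hc₁
  · exact ContinuousLinearMap.toSpanSingletonCLE.continuous.continuousAt.comp hc₂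

section Segment

variable {F : Type*} [NormedAddCommGroup F] [InnerProductSpace ℝ F]

open scoped RealInnerProductSpace

lemma abs_inner_lt_norm_mul_norm_of_forall_add_smul_ne_zero {w d : F}
    (h : ∀ s : ℝ, w + s • d ≠ 0) (hd : d ≠ 0) : |⟪w, d⟫| < ‖w‖ * ‖d‖ := by
  refine lt_of_le_of_ne (abs_real_inner_le_norm w d) fun heq ↦ ?_
  have hw : w ≠ 0 := by simpa using h 0
  obtain ⟨-, r, -, hr⟩ := (abs_real_inner_div_norm_mul_norm_eq_one_iff d w).1 (by
    rw [abs_div, real_inner_comm, heq, mul_comm, abs_mul, abs_norm, abs_norm]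
    exact div_self (mul_ne_zero (norm_ne_zero_iff.2 hd) (norm_ne_zero_iff.2 hw)))
  exact h (-r) (by simp [hr])

lemma norm_lt_norm_add_norm_of_forall_add_smul_ne_zero {w d : F}
    (h : ∀ s : ℝ, w + s • d ≠ 0) (hd : d ≠ 0) : ‖d‖ < ‖w‖ + ‖w + d‖ := by
  have h1 := abs_inner_lt_norm_mul_norm_of_forall_add_smul_ne_zero h hd
  have h2 : ‖w + d‖ ^ 2 = ‖w‖ ^ 2 + 2 * ⟪w, d⟫ + ‖d‖ ^ 2 := norm_add_sq_real w d
  have h3 : (‖d‖ - ‖w‖) ^ 2 < ‖w + d‖ ^ 2 := by nlinarith [neg_abs_le ⟪w, d⟫]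
  linarith [lt_of_pow_lt_pow_left₀ 2 (norm_nonneg _) h3]

lemma integral_inv_norm_add_smul {w d : F} (hd : d ≠ 0) (h : ∀ s : ℝ, w + s • d ≠ 0) :
    ∫ s in (0 : ℝ)..1, ‖w + s • d‖⁻¹ =
      ‖d‖⁻¹ * Real.log ((‖w‖ + ‖w + d‖ + ‖d‖) / (‖w‖ + ‖w + d‖ - ‖d‖)) := by
  have hl : 0 < ‖d‖ := norm_pos_iff.2 hd
  have hn : ∀ s : ℝ, 0 < ‖w + s • d‖ := fun s ↦ norm_pos_iff.2 (h s)
  have hinner : ∀ s : ℝ, ⟪w + s • d, d⟫ = s * ‖d‖ ^ 2 + ⟪w, d⟫ := fun s ↦ by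
    rw [inner_add_left, real_inner_smul_left, real_inner_self_eq_norm_sq, add_comm]
  have hG : ∀ s : ℝ, 0 < s * ‖d‖ ^ 2 + ⟪w, d⟫ + ‖d‖ * ‖w + s • d‖ := fun s ↦ by
    have h1 := abs_inner_lt_norm_mul_norm_of_forall_add_smul_ne_zero
      (w := w + s • d) (d := d) (fun t ↦ by simpa [add_assoc, ← add_smul] using h (s + t)) hd
    rw [hinner] at h1
    nlinarith [neg_abs_le (s * ‖d‖ ^ 2 + ⟪w, d⟫)]
  have hnorm : ∀ s : ℝ, HasDerivAt (fun s : ℝ ↦ ‖w + s • d‖)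
      ((s * ‖d‖ ^ 2 + ⟪w, d⟫) / ‖w + s • d‖) s := fun s ↦ by
    have h1 : HasDerivAt (fun s : ℝ ↦ w + s • d) d s := by
      simpa using ((hasDerivAt_id s).smul_const d).const_add w
    have h2 := h1.norm_sq.sqrt (by have := hn s; positivity)
    simp only [Real.sqrt_sq (norm_nonneg _), hinner] at h2
    refine h2.congr_deriv ?_
    rw [mul_div_mul_left _ _ two_ne_zero]
  have hprim : ∀ s : ℝ, HasDerivAt
      (fun s : ℝ ↦ ‖d‖⁻¹ * Real.log (s * ‖d‖ ^ 2 + ⟪w, d⟫ + ‖d‖ * ‖w + s • d‖))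
      ‖w + s • d‖⁻¹ s := fun s ↦ by
    have h1 := (((((hasDerivAt_id s).mul_const (‖d‖ ^ 2)).add_const ⟪w, d⟫).add
      ((hnorm s).const_mul ‖d‖)).log (hG s).ne').const_mul ‖d‖⁻¹
    refine h1.congr_deriv ?_
    have key : ∀ {l n m : ℝ}, 0 < l → 0 < n → 0 < m + l * n →
        l⁻¹ * ((1 * l ^ 2 + l * (m / n)) / (m + l * n)) = n⁻¹ := by
      intro l n m hl hn hm
      have h2 : 1 * l ^ 2 + l * (m / n) = l * (m + l * n) * n⁻¹ := by
        field_simp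
        ring
      rw [h2]
      field_simp
    exact key hl (hn s) (hG s)
  rw [intervalIntegral.integral_eq_sub_of_hasDerivAt (fun s _ ↦ hprim s)
    (Continuous.intervalIntegrable (Continuous.inv₀ (by fun_prop) fun s ↦ (hn s).ne') _ _),
    ← mul_sub, ← Real.log_div (hG 1).ne' (hG 0).ne']
  have h0 := hG 0
  have h1 := hG 1
  simp only [one_mul, one_smul, zero_mul, zero_smul, add_zero, zero_add] at h0 h1 ⊢
  have hsq : ‖w + d‖ ^ 2 = ‖w‖ ^ 2 + 2 * ⟪w, d⟫ + ‖d‖ ^ 2 := norm_add_sq_real w d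
  have h4 : 0 < ‖w‖ + ‖w + d‖ - ‖d‖ :=
    sub_pos.2 (norm_lt_norm_add_norm_of_forall_add_smul_ne_zero h hd)
  congr 2
  rw [div_eq_div_iff h0.ne' h4.ne']
  have hβ : ⟪w, d⟫ = (‖w + d‖ ^ 2 - ‖w‖ ^ 2 - ‖d‖ ^ 2) / 2 := by linarith
  rw [hβ]
  ring

lemma rpow_eq_exp_neg_integral_inv_norm {w d : F} (hd : d ≠ 0) (h : ∀ s : ℝ, w + s • d ≠ 0) :
    ((‖w‖ + ‖w + d‖ - ‖d‖) / (‖w‖ + ‖w + d‖ + ‖d‖)) ^ (1 / ‖d‖) =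
      Real.exp (-∫ s in (0 : ℝ)..1, ‖w + s • d‖⁻¹) := by
  have hpos : 0 < ‖w‖ + ‖w + d‖ - ‖d‖ :=
    sub_pos.2 (norm_lt_norm_add_norm_of_forall_add_smul_ne_zero h hd)
  have hl : 0 < ‖d‖ := norm_pos_iff.2 hd
  rw [integral_inv_norm_add_smul hd h, Real.rpow_def_of_pos (by positivity), ← inv_div,
    Real.log_inv]
  congr 1
  ring

end Segment

section Potential

variable {F : Type*} [NormedAddCommGroup F] [InnerProductSpace ℝ F]

lemma continuousOn_inv_norm_comp (L : (ℝ × ℝ) ≃L[ℝ] F) :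
    ContinuousOn (fun z ↦ ‖L z‖⁻¹) {0}ᶜ := by
  refine ContinuousOn.inv₀ (by fun_prop) fun z hz ↦ ?_
  simpa using hz

lemma locallyIntegrable_inv_norm_comp (L : (ℝ × ℝ) ≃L[ℝ] F) :
    LocallyIntegrable fun z ↦ ‖L z‖⁻¹ := by
  have hmeas : Measurable fun z : ℝ × ℝ ↦ ‖L z‖⁻¹ :=
    (L.continuous.norm.measurable).inv
  obtain ⟨K, hK⟩ : ∃ K, AntilipschitzWith K L := ⟨_, L.antilipschitz⟩
  refine locallyIntegrable_of_norm_le_rpow (by simp) (C := K) (α := 1) (by simp)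
    (Filter.Eventually.of_forall fun z ↦ ?_) hmeas.aestronglyMeasurable
  rcases eq_or_ne z 0 with rfl | hz
  · simp [Real.zero_rpow]
  have hz' : 0 < ‖z‖ := norm_pos_iff.2 hz
  have hL : 0 < ‖L z‖ := norm_pos_iff.2 (by simpa using hz)
  have h := hK.le_mul_dist z 0
  rw [map_zero, dist_zero_right, dist_zero_right] at h
  rw [norm_inv, norm_norm, Real.rpow_neg_one, ← div_eq_mul_inv, le_div_iff₀ hz',
    inv_mul_le_iff₀ hL, mul_comm]
  exact h

/-- Changing variables by an affine isomorphism multiplies the potential by a nonzero constant. -/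
lemma exists_setIntegral_inv_dist_eq [MeasurableSpace F] [BorelSpace F] [FiniteDimensional ℝ F]
    (μ : Measure F) [μ.IsAddHaarMeasure] (A : F) (L : (ℝ × ℝ) ≃L[ℝ] F) (S : Set (ℝ × ℝ)) :
    ∃ c : ℝ, c ≠ 0 ∧ ∀ p, ∫ Q in (fun z ↦ A + L z) '' S, (dist (A + L p) Q)⁻¹ ∂μ =
      c * ∫ z in S, ‖L (z - p)‖⁻¹ := by
  let ν : Measure F := Measure.map L volume
  have : ν.IsAddHaarMeasure := L.isAddHaarMeasure_map volume
  have hφ : MeasurePreserving (fun z ↦ A + L z) volume ν :=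
    (measurePreserving_add_left ν A).comp (L.continuous.measurable.measurePreserving volume)
  have hemb : MeasurableEmbedding fun z ↦ A + L z :=
    (L.toHomeomorph.trans (Homeomorph.addLeft A)).measurableEmbedding
  refine ⟨μ.addHaarScalarFactor ν, ?_, fun p ↦ ?_⟩
  · exact_mod_cast (Measure.addHaarScalarFactor_pos_of_isAddHaarMeasure μ ν).ne'
  · conv_lhs => rw [Measure.isAddLeftInvariant_eq_smul μ ν]
    rw [Measure.restrict_smul, integral_smul_nnreal_measure, hφ.setIntegral_image_emb hemb,
      NNReal.smul_def, smul_eq_mul]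
    simp_rw [dist_add_left, dist_comm (L p), dist_eq_norm, map_sub]

lemma convexHull_triple_eq_image_unitTriangle (A B C : F) (L : (ℝ × ℝ) ≃L[ℝ] F)
    (h₁ : L (1, 0) = B - A) (h₂ : L (0, 1) = C - A) :
    convexHull ℝ {A, B, C} = (fun z ↦ A + L z) '' unitTriangle := by
  have hL : ∀ x y : ℝ, L (x, y) = x • (B - A) + y • (C - A) := fun x y ↦ by
    rw [← h₁, ← h₂, ← map_smul, ← map_smul, ← map_add]
    simp
  have hconv : Convex ℝ unitTriangle := by
    rintro ⟨x, y⟩ ⟨h1, h2, h3⟩ ⟨x', y'⟩ ⟨h1', h2', h3'⟩ a b ha hb hab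
    simp only at h1 h2 h3 h1' h2' h3'
    refine ⟨?_, ?_, ?_⟩ <;>
      simp only [Prod.smul_mk, Prod.mk_add_mk, smul_eq_mul]
    · positivity
    · positivity
    · nlinarith
  apply subset_antisymm
  · refine convexHull_min ?_ ?_
    · rintro Q (rfl | rfl | rfl)
      · exact ⟨0, by simp [unitTriangle], by simp⟩
      · exact ⟨(1, 0), by simp [unitTriangle], by simp [h₁]⟩
      · exact ⟨(0, 1), by simp [unitTriangle], by simp [h₂]⟩
    · have := (hconv.linear_image L.toLinearEquiv.toLinearMap).translate A
      rw [Set.image_image] at this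
      exact this
  · rintro _ ⟨⟨x, y⟩, ⟨hx, hy, hxy⟩, rfl⟩
    simp only at hx hy hxy
    have hmem := (convex_convexHull ℝ {A, B, C}).sum_mem (t := Finset.univ)
      (w := ![1 - x - y, x, y]) (z := ![A, B, C])
      (by intro i _; fin_cases i <;> simp <;> linarith) (by simp [Fin.sum_univ_three]; ring)
      (by
        intro i _
        apply subset_convexHull
        fin_cases i <;> simp)
    convert hmem using 1
    simp only [hL, Fin.sum_univ_three, Matrix.cons_val]
    module

lemma interior_unitTriangle_subset :
    interior unitTriangle ⊆ {z | 0 < z.1 ∧ 0 < z.2 ∧ z.1 + z.2 < 1} := by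
  rintro ⟨u, v⟩ h
  rw [mem_interior_iff_mem_nhds, Metric.mem_nhds_iff] at h
  obtain ⟨ε, hε, h⟩ := h
  have key : ∀ t : ℝ, |t| = ε / 2 → (u + t, v + t) ∈ unitTriangle := fun t ht ↦ h (by
    rw [Metric.mem_ball, dist_eq_norm]
    simp [Prod.norm_def, ht, hε])
  have h1 := key (ε / 2) (abs_of_pos (by linarith))
  have h2 := key (-(ε / 2)) (by rw [abs_neg, abs_of_pos (by linarith)])
  simp only [unitTriangle, Set.mem_ofPred_eq] at h1 h2 ⊢
  exact ⟨by linarith, by linarith, by linarith⟩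

lemma AffineIndependent.exists_continuousLinearEquiv {A B C : EuclideanSpace ℝ (Fin 2)}
    (h : AffineIndependent ℝ ![A, B, C]) :
    ∃ L : (ℝ × ℝ) ≃L[ℝ] EuclideanSpace ℝ (Fin 2), L (1, 0) = B - A ∧ L (0, 1) = C - A := by
  have hli : LinearIndependent ℝ ![B - A, C - A] := by
    have := (affineIndependent_iff_linearIndependent_vsub ℝ _ (0 : Fin 3)).1 h
    have h2 := this.comp (fun i : Fin 2 ↦ (⟨i.succ, Fin.succ_ne_zero i⟩ : {x : Fin 3 // x ≠ 0}))
      (fun i j hij ↦ by simpa using hij)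
    have hfam : ![B - A, C - A] = (fun i : {x : Fin 3 // x ≠ 0} ↦ ![A, B, C] i -ᵥ ![A, B, C] 0) ∘
        fun i : Fin 2 ↦ ⟨i.succ, Fin.succ_ne_zero i⟩ := by
      ext i : 1
      fin_cases i <;> simp
    rw [hfam]
    exact h2
  let M : ℝ × ℝ →ₗ[ℝ] EuclideanSpace ℝ (Fin 2) :=
    (LinearMap.toSpanSingleton ℝ _ (B - A)).coprod (LinearMap.toSpanSingleton ℝ _ (C - A))
  have hM : Function.Injective M := by
    rw [injective_iff_map_eq_zero]
    rintro ⟨x, y⟩ hxy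
    have := LinearIndependent.pair_iff.1 hli x y (by simpa [M] using hxy)
    simp [this]
  have h₁ : M (1, 0) = B - A := by simp [M]
  have h₂ : M (0, 1) = C - A := by simp [M]
  exact ⟨(LinearEquiv.ofInjectiveOfFinrankEq M hM (by simp)).toContinuousLinearEquiv, h₁, h₂⟩

end Potential

section Stationary

lemma hasDerivAt_of_hasFDerivAt_zero {W : ℝ × ℝ → ℝ} {u v : ℝ}
    (hW : HasFDerivAt W (0 : ℝ × ℝ →L[ℝ] ℝ) (u, v)) :
    HasDerivAt (fun t ↦ W (t, v)) 0 u ∧ HasDerivAt (fun t ↦ W (u, t)) 0 v := by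
  constructor
  · exact hW.comp_hasDerivAt u ((hasDerivAt_id u).prodMk (hasDerivAt_const u v))
  · exact hW.comp_hasDerivAt v ((hasDerivAt_const v u).prodMk (hasDerivAt_id v))

/-- At a critical point of the potential of the unit triangle, the three edge integrals agree. -/
lemma edge_integrals_eq_of_hasFDerivAt_zero {f : ℝ × ℝ → ℝ} (hfc : ContinuousOn f {0}ᶜ)
    (hf : LocallyIntegrable f) {u v : ℝ} (hu : 0 < u) (hv : 0 < v) (huv : u + v < 1)
    (h : HasFDerivAt (fun p : ℝ × ℝ ↦ ∫ z in unitTriangle, f (z - p))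
      (0 : ℝ × ℝ →L[ℝ] ℝ) (u, v)) :
    ∫ s in (0 : ℝ)..1, f (-u, s - v) = ∫ s in (0 : ℝ)..1, f (1 - s - u, s - v) ∧
    ∫ s in (0 : ℝ)..1, f (s - u, -v) = ∫ s in (0 : ℝ)..1, f (s - u, 1 - s - v) := by
  obtain ⟨h₁, h₂⟩ := hasDerivAt_of_hasFDerivAt_zero h
  have e₁ := (hasDerivAt_setIntegral_unitTriangle hfc hf hu huv).unique h₁
  have e₂ := (hasDerivAt_setIntegral_unitTriangle_snd hfc hf hv huv).unique h₂
  have hint : ∀ x y : ℝ → ℝ, Continuous x → Continuous y → (∀ s, (x s, y s) ≠ 0) →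
      IntervalIntegrable (fun s ↦ f (x s, y s)) volume 0 1 := fun x y hx hy hxy ↦
    (hfc.comp_continuous (hx.prodMk hy) hxy).intervalIntegrable _ _
  rw [intervalIntegral.integral_sub, sub_eq_zero] at e₁ e₂
  · exact ⟨e₁, e₂⟩
  all_goals
    refine hint _ _ (by fun_prop) (by fun_prop) fun s hs ↦ ?_
    rw [Prod.mk_eq_zero] at hs
    linarith [hs.1, hs.2]

end Stationary



theorem stationary_point_distance_relation
    (A B C : EuclideanSpace ℝ (Fin 2))
    (hABC : AffineIndependent ℝ ![A, B, C])
    (T : Set (EuclideanSpace ℝ (Fin 2)))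
    (hT : T = convexHull ℝ {A, B, C})
    (V : EuclideanSpace ℝ (Fin 2) → ℝ)
    (hV : ∀ P, V P = ∫ Q in T, (dist P Q)⁻¹ ∂volume)
    (P : EuclideanSpace ℝ (Fin 2)) (hP : P ∈ interior T)
    (hgrad : gradient V P = 0)
    (a b c rA rB rC : ℝ)
    (ha : a = dist B C) (hb : b = dist C A) (hc : c = dist A B)
    (hrA : rA = dist P A) (hrB : rB = dist P B) (hrC : rC = dist P C) :
    ((rB + rC - a) / (rB + rC + a)) ^ (1 / a : ℝ)
      = ((rC + rA - b) / (rC + rA + b)) ^ (1 / b : ℝ) ∧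
    ((rC + rA - b) / (rC + rA + b)) ^ (1 / b : ℝ)
      = ((rA + rB - c) / (rA + rB + c)) ^ (1 / c : ℝ) := by
  obtain ⟨L, hL₁, hL₂⟩ := hABC.exists_continuousLinearEquiv
  have hT' := hT.trans (convexHull_triple_eq_image_unitTriangle A B C L hL₁ hL₂)
  have hLxy : ∀ x y : ℝ, L (x, y) = x • (B - A) + y • (C - A) := fun x y ↦ by
    rw [← hL₁, ← hL₂, ← map_smul, ← map_smul, ← map_add]
    simp
  let φ := L.toHomeomorph.trans (Homeomorph.addLeft A)
  have hP' : P ∈ φ '' interior unitTriangle := by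
    rw [φ.image_interior]
    exact hT' ▸ hP
  obtain ⟨⟨u, v⟩, hz, hPz⟩ := hP'
  obtain ⟨hu, hv, huv⟩ := interior_unitTriangle_subset hz
  simp only at hu hv huv
  replace hPz : P = A + L (u, v) := hPz.symm
  let f : ℝ × ℝ → ℝ := fun z ↦ ‖L z‖⁻¹
  have hfc : ContinuousOn f {0}ᶜ := continuousOn_inv_norm_comp L
  have hf : LocallyIntegrable f := locallyIntegrable_inv_norm_comp L
  let W : ℝ × ℝ → ℝ := fun p ↦ ∫ z in unitTriangle, f (z - p)
  obtain ⟨k, hk, hVk⟩ := exists_setIntegral_inv_dist_eq volume A L unitTriangle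
  have hVW : ∀ p, V (A + L p) = k * W p := fun p ↦ by rw [hV, hT', hVk]
  have hcrit : HasFDerivAt W (0 : ℝ × ℝ →L[ℝ] ℝ) (u, v) := by
    have hVeq : V = fun Q ↦ k * W (L.symm (Q - A)) := by
      ext Q
      rw [← hVW]
      simp
    have hpre : L.symm (P - A) = (u, v) := by simp [hPz]
    have hVdiff : DifferentiableAt ℝ V P := by
      have hWd : DifferentiableAt ℝ W (L.symm (P - A)) :=
        hpre ▸ differentiableAt_setIntegral_unitTriangle hfc hf hu hv huv
      rw [hVeq]
      exact (hWd.comp P (f := fun Q ↦ L.symm (Q - A)) (by fun_prop)).const_mul k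
    have hVd : HasFDerivAt V (0 : EuclideanSpace ℝ (Fin 2) →L[ℝ] ℝ) (A + L (u, v)) := by
      have := hVdiff.hasGradientAt.hasFDerivAt
      rwa [hgrad, map_zero, hPz] at this
    have hWV : W = fun p ↦ k⁻¹ * V (A + L p) := by
      ext p
      rw [hVW, inv_mul_cancel_left₀ hk]
    have hA : HasFDerivAt (fun p ↦ A + L p) (L : ℝ × ℝ →L[ℝ] _) (u, v) :=
      L.hasFDerivAt.const_add A
    rw [hWV]
    simpa using (hVd.comp (u, v) hA).const_mul k⁻¹
  obtain ⟨e₁, e₂⟩ := edge_integrals_eq_of_hasFDerivAt_zero hfc hf hu hv huv hcrit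
  have hP₀ : ∀ x y : ℝ, A + L (x, y) - P = L (x - u, y - v) := fun x y ↦ by
    rw [hPz, add_sub_add_left_eq_sub, ← map_sub, Prod.mk_sub_mk]
  have hB : B = A + L (1, 0) := by simp [hL₁]
  have hC : C = A + L (0, 1) := by simp [hL₂]
  have hA : A = A + L (0, 0) := by simp [hLxy]
  have side : ∀ (x y x' y' : ℝ), (x', y') ≠ (x, y) →
      (∀ s : ℝ, (x + s * (x' - x) - u, y + s * (y' - y) - v) ≠ 0) →
      ((dist P (A + L (x, y)) + dist P (A + L (x', y')) - dist (A + L (x, y)) (A + L (x', y'))) /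
        (dist P (A + L (x, y)) + dist P (A + L (x', y')) + dist (A + L (x, y)) (A + L (x', y')))) ^
          (1 / dist (A + L (x, y)) (A + L (x', y'))) =
      Real.exp (-∫ s in (0 : ℝ)..1, f (x + s * (x' - x) - u, y + s * (y' - y) - v)) := by
    intro x y x' y' hne hline
    have hw : ∀ s : ℝ, L (x - u, y - v) + s • L (x' - x, y' - y) =
        L (x + s * (x' - x) - u, y + s * (y' - y) - v) := fun s ↦ by
      rw [← map_smul, ← map_add]
      congr 1
      ext <;> simp <;> ring
    have hd : L (x' - x, y' - y) ≠ 0 := by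
      rw [← Prod.mk_sub_mk, map_ne_zero_iff L L.injective]
      exact sub_ne_zero.2 hne
    have hmain := rpow_eq_exp_neg_integral_inv_norm hd (w := L (x - u, y - v)) fun s ↦ by
      rw [hw, map_ne_zero_iff L L.injective]
      exact hline s
    have hw1 : L (x - u, y - v) + L (x' - x, y' - y) = L (x' - u, y' - v) := by
      rw [← map_add]
      simp
    have hd' : dist (A + L (x, y)) (A + L (x', y')) = ‖L (x' - x, y' - y)‖ := by
      rw [dist_add_left, dist_comm, dist_eq_norm, ← map_sub, Prod.mk_sub_mk]
    simp_rw [hw, hw1] at hmain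
    rw [dist_comm P, dist_comm P, dist_eq_norm _ P, dist_eq_norm _ P, hP₀, hP₀, hd']
    exact hmain
  have hAC := side 0 0 0 1 (by simp) fun s hs ↦ by
    rw [Prod.mk_eq_zero] at hs
    linarith [hs.1]
  have hAB := side 0 0 1 0 (by simp) fun s hs ↦ by
    rw [Prod.mk_eq_zero] at hs
    linarith [hs.2]
  have hBC := side 1 0 0 1 (by simp) fun s hs ↦ by
    rw [Prod.mk_eq_zero] at hs
    linarith [hs.1, hs.2]
  have hCB := side 0 1 1 0 (by simp) fun s hs ↦ by
    rw [Prod.mk_eq_zero] at hs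
    linarith [hs.1, hs.2]
  rw [← hA, ← hC] at hAC
  rw [← hA, ← hB] at hAB
  rw [← hB, ← hC] at hBC hCB
  subst ha hb hc hrA hrB hrC
  have t₁ : ∀ s : ℝ, (1 + s * (0 - 1) - u, 0 + s * (1 - 0) - v) = (1 - s - u, s - v) := fun s ↦ by
    ext
    · simp
      ring
    · simp
  have t₂ : ∀ s : ℝ, (0 + s * (1 - 0) - u, 1 + s * (0 - 1) - v) = (s - u, 1 - s - v) := fun s ↦ by
    ext
    · simp
    · simp
      ring
  have t₃ : ∀ s : ℝ, (0 + s * (0 - 0) - u, 0 + s * (1 - 0) - v) = (-u, s - v) := fun s ↦ by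
    simp
  have t₄ : ∀ s : ℝ, (0 + s * (1 - 0) - u, 0 + s * (0 - 0) - v) = (s - u, -v) := fun s ↦ by
    simp
  simp_rw [t₁] at hBC
  simp_rw [t₂] at hCB
  simp_rw [t₃] at hAC
  simp_rw [t₄] at hAB
  rw [e₁] at hAC
  rw [e₂] at hAB
  rw [dist_comm C B, add_comm (dist P C)] at hCB
  rw [dist_comm C A, add_comm (dist P C)]
  exact ⟨hBC.trans hAC.symm, (hAC.trans hBC.symm).trans (hCB.trans hAB.symm)⟩
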